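/- arXiv:2508.18844 — 2 statements merged into one kernel-verified Lean document; each statement's English description precedes it below -/
import Mathlib

section
/- Let 2 ≤ ℓ ≤ m−2 and let Π be a hyperplane of the Plücker projective space P(⋀^ℓ V) that is not decomposable. Suppose there exists an (m−1)-dimensional subspace W of V such that |{L ∈ G(ℓ,W) : L lies on Π}| = [m−1 ℓ]_q − q^{ℓ(m−1−ℓ)} = e(ℓ,m−1). Then |Π ∩ G(ℓ,V)| ≤ e'(ℓ,m) = [m ℓ]_q − q^{ℓ(m−ℓ)} − q^{ℓ(m−ℓ)−2}. -/
open Module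

/-- The Gaussian binomial coefficient `[m ℓ]_q`, as a rational number. -/
noncomputable def gaussBinom (q m l : ℕ) : ℚ :=
  ∏ i ∈ Finset.range l, ((q : ℚ) ^ (m - i) - 1) / ((q : ℚ) ^ (i + 1) - 1)

/-- `e(ℓ,m) = [m ℓ]_q − q^{ℓ(m−ℓ)}`. -/
noncomputable def eG (q l m : ℕ) : ℚ :=
  gaussBinom q m l - (q : ℚ) ^ (l * (m - l))

/-- `e'(ℓ,m) = [m ℓ]_q − q^{ℓ(m−ℓ)} − q^{ℓ(m−ℓ)−2}`. -/
noncomputable def eG' (q l m : ℕ) : ℚ :=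
  gaussBinom q m l - (q : ℚ) ^ (l * (m - l)) - (q : ℚ) ^ (l * (m - l) - 2)

variable (F : Type*) [Field F] (V : Type*) [AddCommGroup V] [Module F V]

/-- The wedge product `v₁ ∧ ⋯ ∧ vₙ` as an element of the `n`-th exterior power. -/
noncomputable def wedge (n : ℕ) (v : Fin n → V) : ⋀[F]^n V :=
  ⟨ExteriorAlgebra.ιMulti F n v, ExteriorAlgebra.ιMulti_range F n (Set.mem_range_self v)⟩

/-- The product `w₁ ∧ ⋯ ∧ w_k ∧ x` for `x` in the `l`-th exterior power, landing in the
`n`-th exterior power, where `k + l = n`. -/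
noncomputable def mulWedge (k l n : ℕ) (h : k + l = n) (w : Fin k → V) (x : ⋀[F]^l V) :
    ⋀[F]^n V :=
  ⟨ExteriorAlgebra.ιMulti F k w * (x : ExteriorAlgebra F V), by
    subst h
    have hmem : ExteriorAlgebra.ιMulti F k w * (x : ExteriorAlgebra F V) ∈
        (LinearMap.range (ExteriorAlgebra.ι F : V →ₗ[F] ExteriorAlgebra F V)) ^ k *
          (LinearMap.range (ExteriorAlgebra.ι F : V →ₗ[F] ExteriorAlgebra F V)) ^ l :=
      Submodule.mul_mem_mul (ExteriorAlgebra.ιMulti_range F k (Set.mem_range_self w)) x.2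
    rw [← pow_add] at hmem
    exact hmem⟩

/-- An `ℓ`-dimensional subspace `L` of `V` lies on the hyperplane of the Plücker projective
space determined by the nonzero functional `φ : ⋀[F]^ℓ V →ₗ[F] F` if
`φ (ω₁ ∧ ⋯ ∧ ω_ℓ) = 0` for some (equivalently, every) basis `ω₁, …, ω_ℓ` of `L`. -/
def LiesOn (l : ℕ) (φ : ⋀[F]^l V →ₗ[F] F) (L : Submodule F V) : Prop :=
  ∃ ω : Fin l → V, (∀ i, ω i ∈ L) ∧ LinearIndependent F ω ∧
    Submodule.span F (Set.range ω) = L ∧ φ (wedge F V l ω) = 0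

/-- The hyperplane determined by `φ : ⋀[F]^ℓ V →ₗ[F] F` is decomposable if there exist vectors
`w₁, …, w_{m−ℓ} ∈ V` and a nonzero linear functional `ψ : ⋀[F]^m V →ₗ[F] F` such that
`φ x = ψ (w₁ ∧ ⋯ ∧ w_{m−ℓ} ∧ x)` for all `x ∈ ⋀[F]^ℓ V`. -/
def IsDecomposable (m l : ℕ) (h : l ≤ m) (φ : ⋀[F]^l V →ₗ[F] F) : Prop :=
  ∃ (w : Fin (m - l) → V) (ψ : ⋀[F]^m V →ₗ[F] F), ψ ≠ 0 ∧
    ∀ x : ⋀[F]^l V, φ x = ψ (mulWedge F V (m - l) l m (Nat.sub_add_cancel h) w x)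

namespace PluckerHyperplane

open Finset

open scoped Matrix Classical

section Linear

variable {F V}

/-- An invertible matrix moving a given nonzero vector to the first standard basis vector. -/
theorem exists_det_ne_zero_mulVec_eq_single {k : ℕ} (t : Fin (k + 1) → F) (ht : t ≠ 0) :
    ∃ M : Matrix (Fin (k + 1)) (Fin (k + 1)) F, M.det ≠ 0 ∧ M *ᵥ t = Pi.single 0 1 := by
  obtain ⟨j, hj⟩ := Function.ne_iff.1 ht
  let N : Matrix (Fin (k + 1)) (Fin (k + 1)) F :=
    ((1 : Matrix (Fin (k + 1)) (Fin (k + 1)) F).updateCol j t).submatrix id (Equiv.swap 0 j)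
  have hN : N.det ≠ 0 := by
    rw [Matrix.det_permute', ← Matrix.cramer_apply, Matrix.cramer_one]
    refine mul_ne_zero ?_ hj
    rcases Int.units_eq_one_or (Equiv.Perm.sign (Equiv.swap 0 j)) with h | h <;> simp [h]
  have ht' : N *ᵥ Pi.single 0 1 = t := by
    ext i
    simp [N]
  refine ⟨N⁻¹, by simpa [Matrix.det_nonsing_inv] using hN, ?_⟩
  rw [← ht', Matrix.mulVec_mulVec, Matrix.nonsing_inv_mul _ hN.isUnit, Matrix.one_mulVec]

/-- The action of a matrix on tuples of vectors. -/
def tupleAct {k : ℕ} (M : Matrix (Fin k) (Fin k) F) (a : Fin k → V) : Fin k → V :=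
  fun i ↦ ∑ j, M i j • a j

theorem tupleAct_mul {k : ℕ} (M N : Matrix (Fin k) (Fin k) F) (a : Fin k → V) :
    tupleAct (M * N) a = tupleAct M (tupleAct N a) := by
  ext i
  simp only [tupleAct, Matrix.mul_apply, sum_smul, smul_sum, smul_smul]
  exact sum_comm

theorem tupleAct_one {k : ℕ} (a : Fin k → V) : tupleAct (1 : Matrix (Fin k) (Fin k) F) a = a := by
  ext i
  simp [tupleAct, Matrix.one_apply]

theorem tupleAct_add_smul {k : ℕ} (M : Matrix (Fin k) (Fin k) F) (a : Fin k → V)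
    (t : Fin k → F) (v : V) :
    tupleAct M (fun i ↦ a i + t i • v) = fun i ↦ tupleAct M a i + (M *ᵥ t) i • v := by
  ext i
  simp [tupleAct, Matrix.mulVec, dotProduct, sum_smul, smul_smul, sum_add_distrib]

theorem tupleAct_bijective {k : ℕ} {M : Matrix (Fin k) (Fin k) F} (hM : M.det ≠ 0) :
    Function.Bijective (tupleAct (V := V) M) := by
  have hu : IsUnit M.det := hM.isUnit
  refine Function.bijective_iff_has_inverse.2 ⟨tupleAct M⁻¹, fun a ↦ ?_, fun a ↦ ?_⟩
  · rw [← tupleAct_mul, Matrix.nonsing_inv_mul _ hu, tupleAct_one]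
  · rw [← tupleAct_mul, Matrix.mul_nonsing_inv _ hu, tupleAct_one]

theorem map_tupleAct {k : ℕ} (η : V [⋀^Fin k]→ₗ[F] F) (M : Matrix (Fin k) (Fin k) F)
    (a : Fin k → V) : η (tupleAct M a) = M.det * η a := by
  let A : (Fin k → F) →ₗ[F] V := Fintype.linearCombination F a
  have h := (η.compLinearMap A).eq_smul_basis_det (Pi.basisFun F (Fin k))
  have h2 : η (fun i ↦ A (M i)) = η (fun i ↦ A (Pi.basisFun F (Fin k) i)) * M.det := by
    have := congrArg (fun f : (Fin k → F) [⋀^Fin k]→ₗ[F] F ↦ f M) h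
    rw [Pi.basisFun_det] at this
    exact this
  have h3 : (fun i ↦ A (Pi.basisFun F (Fin k) i)) = a := by
    ext i
    simp [A, Fintype.linearCombination_apply_single]
  rw [h3] at h2
  rw [mul_comm, ← h2]
  rfl

theorem map_eq_zero_of_map_eq_zero {k : ℕ} (η : V [⋀^Fin k]→ₗ[F] F) (a b : Fin k → V)
    (hb : ∀ i, b i ∈ Submodule.span F (Set.range a)) (ha : η a = 0) : η b = 0 := by
  have h : ∀ i, ∃ c : Fin k → F, ∑ j, c j • a j = b i := fun i ↦
    (Submodule.mem_span_range_iff_exists_fun F).1 (hb i)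
  choose M hM using h
  have : b = tupleAct (Matrix.of M) a := funext fun i ↦ (hM i).symm
  rw [this, map_tupleAct, ha, mul_zero]

theorem linearIndependent_of_map_ne_zero {k : ℕ} (η : V [⋀^Fin k]→ₗ[F] F) (a : Fin k → V)
    (ha : η a ≠ 0) : LinearIndependent F a := by
  by_contra h
  exact ha (η.map_linearDependent a h)

/-- The radical of an alternating form: the vectors whose contraction with the form vanishes. -/
abbrev radical {k : ℕ} (η : V [⋀^Fin (k + 1)]→ₗ[F] F) : Submodule F V :=
  LinearMap.ker η.curryLeft

theorem map_cons_eq_zero {k : ℕ} {η : V [⋀^Fin (k + 1)]→ₗ[F] F} {u : V} (hu : u ∈ radical η)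
    (a : Fin k → V) : η (Matrix.vecCons u a) = 0 := by
  rw [← AlternatingMap.curryLeft_apply_apply, LinearMap.mem_ker.1 hu]
  rfl

theorem map_eq_zero_of_mem_radical {k : ℕ} {η : V [⋀^Fin (k + 1)]→ₗ[F] F} {a : Fin (k + 1) → V}
    {i : Fin (k + 1)} (hi : a i ∈ radical η) : η a = 0 := by
  by_cases h : i = 0
  · subst h
    have := map_cons_eq_zero hi (Matrix.vecTail a)
    rwa [show Matrix.vecCons (a 0) (Matrix.vecTail a) = a from Matrix.cons_head_tail a] at this
  · have h1 := η.map_swap a h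
    have h2 := map_cons_eq_zero (u := (a ∘ Equiv.swap i 0) 0) (η := η) (by simpa using hi)
      (Matrix.vecTail (a ∘ Equiv.swap i 0))
    rw [show Matrix.vecCons ((a ∘ Equiv.swap i 0) 0) (Matrix.vecTail (a ∘ Equiv.swap i 0)) =
      a ∘ Equiv.swap i 0 from Matrix.cons_head_tail (a ∘ Equiv.swap i 0), h1] at h2
    simpa using h2

theorem map_add_of_mem_radical {k : ℕ} (η : V [⋀^Fin (k + 1)]→ₗ[F] F) (a r : Fin (k + 1) → V)
    (hr : ∀ i, r i ∈ radical η) : η (a + r) = η a := by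
  have key : ∀ s : Finset (Fin (k + 1)), η (fun i ↦ if i ∈ s then a i + r i else a i) = η a := by
    intro s
    induction s using Finset.induction_on with
    | empty => simp
    | insert j s hj ih =>
      have : (fun i ↦ if i ∈ insert j s then a i + r i else a i) =
          Function.update (fun i ↦ if i ∈ s then a i + r i else a i) j (a j + r j) := by
        ext i
        by_cases hij : i = j
        · subst hij; simp
        · simp [hij, Function.update_of_ne]
      rw [this, η.map_update_add]
      have h0 : η (Function.update (fun i ↦ if i ∈ s then a i + r i else a i) j (r j)) = 0 :=
        map_eq_zero_of_mem_radical (i := j) (by simpa using hr j)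
      rw [h0, add_zero]
      have : Function.update (fun i ↦ if i ∈ s then a i + r i else a i) j (a j) =
          fun i ↦ if i ∈ s then a i + r i else a i := by
        rw [Function.update_eq_self_iff]; simp [hj]
      rw [this, ih]
  have h := key univ
  simp only [mem_univ, if_true] at h
  exact h

theorem mem_radical_curryLeft_self {k : ℕ} (η : V [⋀^Fin (k + 2)]→ₗ[F] F) (u : V) :
    u ∈ radical (η.curryLeft u) := by
  rw [LinearMap.mem_ker]; exact η.curryLeft_same u

theorem curryLeft_curryLeft_swap {k : ℕ} (η : V [⋀^Fin (k + 2)]→ₗ[F] F) (u v : V) :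
    (η.curryLeft u).curryLeft v = -(η.curryLeft v).curryLeft u := by
  have := η.curryLeft_same (u + v)
  simp only [map_add, AlternatingMap.curryLeft_add, LinearMap.add_apply,
    AlternatingMap.curryLeft_same, zero_add, add_zero] at this
  rw [eq_neg_iff_add_eq_zero, add_comm]; exact this

theorem radical_le_radical_curryLeft {k : ℕ} (η : V [⋀^Fin (k + 2)]→ₗ[F] F) (u : V) :
    radical η ≤ radical (η.curryLeft u) := by
  intro v hv
  rw [LinearMap.mem_ker, curryLeft_curryLeft_swap, LinearMap.mem_ker.1 hv]
  simp

/-- Translating all the entries of a tuple by multiples of a fixed vector changes the value of an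
alternating form by a linear function of the coefficients. -/
theorem exists_linear_map_add_smul {k : ℕ} (η : V [⋀^Fin k]→ₗ[F] F) (a : Fin k → V) (u : V) :
    ∃ h : (Fin k → F) →ₗ[F] F, ∀ s, η (fun i ↦ a i + s i • u) = η a + h s := by
  induction k with
  | zero => exact ⟨0, fun s ↦ by simpa using congrArg η (Subsingleton.elim _ _)⟩
  | succ k ih =>
    obtain ⟨h, hh⟩ := ih (η.curryLeft (a 0)) (Matrix.vecTail a)
    refine ⟨η (Matrix.vecCons u (Matrix.vecTail a)) • LinearMap.proj 0 +
      h ∘ₗ LinearMap.funLeft F F Fin.succ, fun s ↦ ?_⟩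
    have e1 : (fun i ↦ a i + s i • u) = Matrix.vecCons (a 0 + s 0 • u)
        (fun i ↦ Matrix.vecTail a i + s i.succ • u) := by
      ext i
      refine Fin.cases rfl (fun i ↦ rfl) i
    have e2 := hh (fun i ↦ s i.succ)
    rw [AlternatingMap.curryLeft_apply_apply, AlternatingMap.curryLeft_apply_apply] at e2
    have e3 : η (Matrix.vecCons u (fun i ↦ Matrix.vecTail a i + s i.succ • u)) =
        η (Matrix.vecCons u (Matrix.vecTail a)) := by
      cases k with
      | zero => exact congrArg η (by congr 1; exact Subsingleton.elim _ _)
      | succ k =>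
        rw [← AlternatingMap.curryLeft_apply_apply, ← AlternatingMap.curryLeft_apply_apply]
        exact map_add_of_mem_radical _ _ _ fun i ↦
          Submodule.smul_mem _ _ (mem_radical_curryLeft_self η u)
    rw [e1, η.map_vecCons_add, η.map_vecCons_smul, e2, e3,
      show Matrix.vecCons (a 0) (Matrix.vecTail a) = a from Matrix.cons_head_tail a]
    simp only [LinearMap.add_apply, LinearMap.smul_apply, LinearMap.proj_apply, smul_eq_mul,
      LinearMap.comp_apply]
    rw [show LinearMap.funLeft F F Fin.succ s = fun i ↦ s i.succ from rfl]
    ring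

/-- An alternating form vanishes if it vanishes on tuples with an entry in a subspace `K` and on
tuples with entries in a family that spans the space together with `K`. -/
theorem eq_zero_of_span_sup_eq_top {k : ℕ} {ι : Type*} (ξ : V [⋀^Fin k]→ₗ[F] F)
    (K : Submodule F V) (e : ι → V) (hspan : Submodule.span F (Set.range e) ⊔ K = ⊤)
    (hK : ∀ a i, a i ∈ K → ξ a = 0) (he : ∀ v : Fin k → ι, ξ (e ∘ v) = 0) : ξ = 0 := by
  have hs : Submodule.span F (Set.range (Sum.elim e ((↑) : K → V))) = ⊤ := by
    rw [Set.Sum.elim_range, Submodule.span_union, Subtype.range_coe_subtype]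
    simpa using hspan
  have : ξ.toMultilinearMap = 0 := by
    refine MultilinearMap.ext_of_span_eq_top (g := fun _ ↦ Sum.elim e ((↑) : K → V))
      (fun _ ↦ hs) fun j ↦ ?_
    by_cases h : ∃ i, ∃ x, j i = Sum.inr x
    · obtain ⟨i, x, hi⟩ := h
      exact hK _ i (by simp [hi])
    · have hv : ∀ i, ∃ x, j i = Sum.inl x := by
        intro i
        rcases hji : j i with x | x
        · exact ⟨x, rfl⟩
        · exact absurd ⟨i, x, hji⟩ h
      choose v hv using hv
      have := he v
      simp only [hv, Sum.elim_inl]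
      exact this
  ext a
  exact congrArg (fun f : MultilinearMap F (fun _ : Fin k ↦ V) F ↦ f a) this

/-- The linear map sending a vector to the values of a form on the tuples obtained from `e` by
replacing one entry with that vector. -/
noncomputable def updateMap {k : ℕ} (η : V [⋀^Fin k]→ₗ[F] F) (e : Fin k → V) :
    V →ₗ[F] (Fin k → F) :=
  LinearMap.pi fun i ↦ η.toMultilinearMap.toLinearMap e i

theorem updateMap_apply {k : ℕ} (η : V [⋀^Fin k]→ₗ[F] F) (e : Fin k → V) (v : V) (i : Fin k) :
    updateMap η e v i = η (Function.update e i v) := rfl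

theorem updateMap_self {k : ℕ} (η : V [⋀^Fin k]→ₗ[F] F) (e : Fin k → V) (j : Fin k) :
    updateMap η e (e j) = Pi.single j (η e) := by
  ext i
  rw [updateMap_apply]
  by_cases h : i = j
  · subst h; simp
  · rw [Pi.single_eq_of_ne h]
    exact η.map_eq_zero_of_eq _ (i := i) (j := j) (by simp [Function.update_of_ne (Ne.symm h)]) h

theorem updateMap_sum_smul {k : ℕ} (η : V [⋀^Fin k]→ₗ[F] F) (e : Fin k → V) (c : Fin k → F) :
    updateMap η e (∑ j, c j • e j) = η e • c := by
  simp only [map_sum, map_smul, updateMap_self]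
  ext i
  simp [Finset.sum_apply, Pi.single_apply, mul_comm]

theorem span_sup_ker_updateMap {k : ℕ} {η : V [⋀^Fin k]→ₗ[F] F} {e : Fin k → V} (he : η e ≠ 0) :
    Submodule.span F (Set.range e) ⊔ LinearMap.ker (updateMap η e) = ⊤ := by
  rw [eq_top_iff]
  intro v _
  let s := ∑ j, ((η e)⁻¹ • updateMap η e v) j • e j
  have hs : s ∈ Submodule.span F (Set.range e) :=
    Submodule.sum_mem _ fun j _ ↦ Submodule.smul_mem _ _ (Submodule.subset_span ⟨j, rfl⟩)
  have hv : v - s ∈ LinearMap.ker (updateMap η e) := by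
    rw [LinearMap.mem_ker, map_sub, updateMap_sum_smul, smul_smul, mul_inv_cancel₀ he, one_smul,
      sub_self]
  simpa using Submodule.add_mem_sup hs hv

theorem finrank_ker_updateMap [FiniteDimensional F V] {k : ℕ} {η : V [⋀^Fin k]→ₗ[F] F}
    {e : Fin k → V} (he : η e ≠ 0) :
    finrank F (LinearMap.ker (updateMap η e)) + k = finrank F V := by
  have hsurj : LinearMap.range (updateMap η e) = ⊤ := by
    rw [LinearMap.range_eq_top]
    intro c
    exact ⟨_, (updateMap_sum_smul η e ((η e)⁻¹ • c)).trans
      (by rw [smul_smul, mul_inv_cancel₀ he, one_smul])⟩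
  have := LinearMap.finrank_range_add_finrank_ker (updateMap η e)
  rw [hsurj, finrank_top, finrank_fin_fun] at this
  omega

theorem radical_le_ker_updateMap {k : ℕ} (η : V [⋀^Fin (k + 1)]→ₗ[F] F) (e : Fin (k + 1) → V) :
    radical η ≤ LinearMap.ker (updateMap η e) := by
  intro v hv
  rw [LinearMap.mem_ker]
  ext i
  exact map_eq_zero_of_mem_radical (i := i) (by simpa using hv)

theorem exists_map_ne_zero {k : ℕ} {η : V [⋀^Fin k]→ₗ[F] F} (h : η ≠ 0) : ∃ e, η e ≠ 0 := by
  by_contra! h'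
  exact h (AlternatingMap.ext h')

theorem finrank_radical_add_le [FiniteDimensional F V] {k : ℕ} {η : V [⋀^Fin (k + 1)]→ₗ[F] F}
    (h : η ≠ 0) : finrank F (radical η) + (k + 1) ≤ finrank F V := by
  obtain ⟨e, he⟩ := exists_map_ne_zero h
  have := Submodule.finrank_mono (radical_le_ker_updateMap η e)
  have := finrank_ker_updateMap he
  omega

/-- A nonzero form whose radical contains a subspace of codimension one more than its degree has
a radical of codimension equal to its degree. -/
theorem ker_updateMap_le_radical [FiniteDimensional F V] {k : ℕ} {η : V [⋀^Fin (k + 1)]→ₗ[F] F}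
    {e : Fin (k + 1) → V} (he : η e ≠ 0) (U : Submodule F V) (hU : U ≤ radical η)
    (hdim : finrank F V ≤ finrank F U + (k + 2)) :
    LinearMap.ker (updateMap η e) ≤ radical η := by
  intro b hb
  by_cases hbU : b ∈ U
  · exact hU hbU
  have hle : Submodule.span F {b} ⊔ U ≤ LinearMap.ker (updateMap η e) :=
    sup_le ((Submodule.span_singleton_le_iff_mem _ _).2 hb)
      (hU.trans (radical_le_ker_updateMap η e))
  have hlt : finrank F U < finrank F ↥(Submodule.span F {b} ⊔ U) :=
    Submodule.finrank_lt_finrank_of_lt (lt_of_le_of_ne le_sup_right fun h ↦ hbU (by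
      rw [h]; exact Submodule.mem_sup_left (Submodule.mem_span_singleton_self b)))
  have hker : Submodule.span F {b} ⊔ U = LinearMap.ker (updateMap η e) :=
    Submodule.eq_of_le_of_finrank_le hle (by have := finrank_ker_updateMap he; omega)
  rw [LinearMap.mem_ker]
  refine eq_zero_of_span_sup_eq_top _ (Submodule.span F {b} ⊔ U) e
    (by rw [hker]; exact span_sup_ker_updateMap he) (fun a i hi ↦ ?_) fun v ↦ ?_
  · cases k with
    | zero => exact i.elim0
    | succ k =>
      refine map_eq_zero_of_mem_radical (i := i) ((?_ : _ ≤ radical (η.curryLeft b)) hi)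
      exact sup_le ((Submodule.span_singleton_le_iff_mem _ _).2 (mem_radical_curryLeft_self η b))
        (hU.trans (radical_le_radical_curryLeft η b))
  · rw [AlternatingMap.curryLeft_apply_apply]
    by_cases hv : Function.Injective v
    · obtain ⟨i, hi⟩ : ∃ i, i ∉ Set.range v := by
        by_contra! h
        have := Fintype.card_le_of_surjective v h
        simp at this
      have hinj : Function.Injective (Matrix.vecCons i v) := by
        rw [Matrix.vecCons, Fin.cons_injective_iff]
        exact ⟨hi, hv⟩
      let σ : Equiv.Perm (Fin (k + 1)) :=
        Equiv.ofBijective _ (Finite.injective_iff_bijective.1 hinj)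
      have : Matrix.vecCons b (e ∘ v) = Function.update e i b ∘ σ := by
        ext j
        refine Fin.cases ?_ (fun j ↦ ?_) j
        · simp [σ]
        · have : v j ≠ i := fun h ↦ hi ⟨j, h⟩
          simp [σ, Function.update_of_ne this]
      have h0 : η (Function.update e i b) = 0 := congrFun (LinearMap.mem_ker.1 hb) i
      rw [this, η.map_perm, h0, smul_zero]
    · rw [Function.not_injective_iff] at hv
      obtain ⟨x, y, hxy, hne⟩ := hv
      exact η.map_eq_zero_of_eq _ (i := x.succ) (j := y.succ) (by simp [hxy])
        (fun h ↦ hne (Fin.succ_injective _ h))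

/-- Two forms of degree `k` killed by a subspace of codimension `k` are proportional. -/
theorem eq_smul_of_ker {k : ℕ} (η θ : V [⋀^Fin k]→ₗ[F] F) (K : Submodule F V) (e : Fin k → V)
    (hspan : Submodule.span F (Set.range e) ⊔ K = ⊤)
    (hη : ∀ a i, a i ∈ K → η a = 0) (hθ : ∀ a i, a i ∈ K → θ a = 0) (he : θ e = 1) :
    η = η e • θ := by
  rw [← sub_eq_zero]
  refine eq_zero_of_span_sup_eq_top _ K e hspan (fun a i hi ↦ ?_) fun v ↦ ?_
  · simp [hη a i hi, hθ a i hi]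
  · by_cases hv : Function.Injective v
    · let σ : Equiv.Perm (Fin k) := Equiv.ofBijective _ (Finite.injective_iff_bijective.1 hv)
      have : e ∘ v = e ∘ σ := rfl
      rw [this, AlternatingMap.map_perm]
      simp [he]
    · rw [Function.not_injective_iff] at hv
      obtain ⟨x, y, hxy, hne⟩ := hv
      exact AlternatingMap.map_eq_zero_of_eq _ _ (i := x) (j := y) (by simp [hxy]) hne

end Linear

section Decomposable

variable {F V}

/-- A functional on an exterior power, viewed as an alternating form. -/
noncomputable abbrev formOf {l : ℕ} (φ : ⋀[F]^l V →ₗ[F] F) : V [⋀^Fin l]→ₗ[F] F :=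
  φ.compAlternatingMap (exteriorPower.ιMulti F l)

theorem formOf_ne_zero {l : ℕ} {φ : ⋀[F]^l V →ₗ[F] F} (h : φ ≠ 0) : formOf φ ≠ 0 := by
  intro h'
  exact h (exteriorPower.linearMap_ext h')

/-- Left multiplication by a wedge of vectors as a linear map. -/
noncomputable def mulWedgeLinear (k l n : ℕ) (h : k + l = n) (w : Fin k → V) :
    ⋀[F]^l V →ₗ[F] ⋀[F]^n V where
  toFun := mulWedge F V k l n h w
  map_add' _ _ := Subtype.ext (mul_add _ _ _)
  map_smul' c _ := Subtype.ext (Algebra.mul_smul_comm c _ _)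

theorem mulWedge_ιMulti (k l n : ℕ) (h : k + l = n) (w : Fin k → V) (a : Fin l → V) :
    mulWedge F V k l n h w (exteriorPower.ιMulti F l a) =
      exteriorPower.ιMulti F n (Fin.append w a ∘ Fin.cast h.symm) := by
  subst h
  apply Subtype.ext
  change ExteriorAlgebra.ιMulti F k w * ExteriorAlgebra.ιMulti F l a =
    ExteriorAlgebra.ιMulti F (k + l) (Fin.append w a)
  exact ExteriorAlgebra.ιMulti_mul_ιMulti ..

theorem linearIndependent_append {k l : ℕ} {w : Fin k → V} {e : Fin l → V}
    (hw : LinearIndependent F w) (he : LinearIndependent F e)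
    (h : Disjoint (Submodule.span F (Set.range w)) (Submodule.span F (Set.range e))) :
    LinearIndependent F (Fin.append w e) := by
  have := hw.sum_type he h
  refine (linearIndependent_equiv finSumFinEquiv).1 ?_
  have h' : Fin.append w e ∘ finSumFinEquiv = Sum.elim w e := by
    ext i
    rcases i with i | i <;> simp
  rw [h']
  exact this

/-- A form whose radical contains a subspace of codimension equal to its degree is
decomposable. -/
theorem isDecomposable_of_ker_updateMap_le [FiniteDimensional F V] {m k : ℕ}
    (hV : finrank F V = m) (hkm : k + 1 ≤ m) (φ : ⋀[F]^(k + 1) V →ₗ[F] F) {e : Fin (k + 1) → V}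
    (he : formOf φ e ≠ 0)
    (hle : LinearMap.ker (updateMap (formOf φ) e) ≤ radical (formOf φ)) :
    IsDecomposable F V m (k + 1) hkm φ := by
  set R := LinearMap.ker (updateMap (formOf φ) e) with hR
  have hspan := span_sup_ker_updateMap he
  have hdim := finrank_ker_updateMap he
  rw [← hR] at hspan hdim
  have heli := linearIndependent_of_map_ne_zero _ e he
  let b := finBasisOfFinrankEq F R (n := m - (k + 1)) (by omega)
  let w : Fin (m - (k + 1)) → V := fun i ↦ (b i : V)
  have hwli : LinearIndependent F w := b.linearIndependent.map' R.subtype R.ker_subtype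
  have hwspan : Submodule.span F (Set.range w) = R := by
    have : Set.range w = R.subtype '' Set.range b := by
      rw [← Set.range_comp]; rfl
    rw [this, ← Submodule.map_span, b.span_eq, Submodule.map_top, Submodule.range_subtype]
  have hdisj : Disjoint R (Submodule.span F (Set.range e)) := by
    rw [Submodule.disjoint_def]
    intro v hv hve
    obtain ⟨c, rfl⟩ := (Submodule.mem_span_range_iff_exists_fun F).1 hve
    rw [hR, LinearMap.mem_ker, updateMap_sum_smul, smul_eq_zero_iff_right he] at hv
    simp [hv]
  have hli := linearIndependent_append hwli heli (by rw [hwspan]; exact hdisj)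
  have hmk : m - (k + 1) + (k + 1) = m := Nat.sub_add_cancel hkm
  have : Nonempty (Fin m) := ⟨⟨0, by omega⟩⟩
  let B : Basis (Fin m) F V := basisOfLinearIndependentOfCardEqFinrank
    (b := Fin.append w e ∘ Fin.cast hmk.symm)
    ((linearIndependent_equiv (finCongr hmk.symm)).2 hli) (by simp [hV])
  have hB : ⇑B = Fin.append w e ∘ Fin.cast hmk.symm :=
    coe_basisOfLinearIndependentOfCardEqFinrank _ _
  let ψ₀ : ⋀[F]^m V →ₗ[F] F := exteriorPower.alternatingMapLinearEquiv B.det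
  let θ := formOf (ψ₀ ∘ₗ mulWedgeLinear (m - (k + 1)) (k + 1) m hmk w)
  have hθ : ∀ a, θ a = B.det (Fin.append w a ∘ Fin.cast hmk.symm) := by
    intro a
    change ψ₀ (mulWedge F V _ _ _ hmk w (exteriorPower.ιMulti F (k + 1) a)) = _
    rw [mulWedge_ιMulti, exteriorPower.alternatingMapLinearEquiv_apply_ιMulti]
  have hθe : θ e = 1 := by rw [hθ, ← hB, B.det_self]
  have hθR : ∀ a i, a i ∈ R → θ a = 0 := by
    intro a i hi
    rw [hθ]
    apply AlternatingMap.map_linearDependent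
    intro hli'
    have hli'' : LinearIndependent F (Fin.append w a) :=
      (linearIndependent_equiv (finCongr hmk.symm)).1 hli'
    have h1 := hli''.notMem_span_image (s := Set.range (Fin.castAdd (k + 1)))
      (x := Fin.natAdd (m - (k + 1)) i) (by
        rintro ⟨j, hj⟩
        have := congrArg Fin.val hj
        simp at this
        omega)
    apply h1
    rw [← Set.range_comp, show Fin.append w a ∘ Fin.castAdd (k + 1) = w from
      funext fun j ↦ by simp, hwspan]
    simpa using hi
  have hprop := eq_smul_of_ker (formOf φ) θ R e hspan
    (fun a i hi ↦ map_eq_zero_of_mem_radical (hle hi)) hθR hθe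
  refine ⟨w, formOf φ e • ψ₀, smul_ne_zero he fun h0 ↦ ?_, fun x ↦ ?_⟩
  · have : θ e = 0 := by
      change ψ₀ _ = 0
      rw [h0]; rfl
    rw [this] at hθe
    exact zero_ne_one hθe
  · have : φ = formOf φ e • (ψ₀ ∘ₗ mulWedgeLinear (m - (k + 1)) (k + 1) m hmk w) :=
      exteriorPower.linearMap_ext hprop
    exact congrArg (fun f : ⋀[F]^(k + 1) V →ₗ[F] F ↦ f x) this

end Decomposable

section Counting

variable {F V} [Fintype V]

/-- The indicator of a proposition, as a rational number. -/
noncomputable abbrev ind (p : Prop) : ℚ := if p then 1 else 0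

theorem ind_nonneg (p : Prop) : 0 ≤ ind p := by
  unfold ind; split_ifs <;> simp

theorem ind_mono {p r : Prop} (h : p → r) : ind p ≤ ind r := by
  unfold ind; split_ifs <;> simp_all

/-- The number of tuples on which an alternating form does not vanish. -/
noncomputable def nonzeroCount {k : ℕ} (η : V [⋀^Fin k]→ₗ[F] F) : ℚ :=
  ∑ a : Fin k → V, ind (η a ≠ 0)

theorem sum_cons {α : Type*} [Fintype α] {k : ℕ} (f : (Fin (k + 1) → α) → ℚ) :
    ∑ a, f a = ∑ x, ∑ a, f (Matrix.vecCons x a) := by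
  rw [← Fintype.sum_prod_type']
  exact (Fintype.sum_equiv (Fin.consEquiv fun _ ↦ α) _ _ fun _ ↦ rfl).symm

theorem nonzeroCount_succ {k : ℕ} (η : V [⋀^Fin (k + 1)]→ₗ[F] F) :
    nonzeroCount η = ∑ x, nonzeroCount (η.curryLeft x) :=
  sum_cons _

theorem sum_eq_sum_single {k : ℕ} (P : (Fin (k + 1) → F) → (Fin (k + 1) → V) → Prop)
    (hP : ∀ (M : Matrix (Fin (k + 1)) (Fin (k + 1)) F), M.det ≠ 0 → ∀ t a,
      P (M *ᵥ t) (tupleAct M a) ↔ P t a) {t : Fin (k + 1) → F} (ht : t ≠ 0) :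
    ∑ a, ind (P t a) = ∑ a, ind (P (Pi.single 0 1) a) := by
  obtain ⟨M, hM, hMt⟩ := exists_det_ne_zero_mulVec_eq_single t ht
  rw [← hMt, ← (tupleAct_bijective (V := V) hM).sum_comp (fun a ↦ ind (P (M *ᵥ t) a))]
  simp only [ind, hP M hM t]

theorem sum_ind_add_ne_zero (f : V →ₗ[F] F) (hf : f ≠ 0) (c : F) :
    ∑ x, ind (c + f x ≠ 0) = ∑ x, ind (f x ≠ 0) := by
  obtain ⟨y, hy⟩ := LinearMap.surjective hf c
  rw [← Equiv.sum_comp (Equiv.addLeft y) (fun x ↦ ind (f x ≠ 0))]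
  simp [hy]

theorem sum_ind_ne_zero_le (f : V →ₗ[F] F) (c : F) :
    ∑ x, ind (f x ≠ 0) ≤ ∑ x, ind (c + f x ≠ 0) := by
  by_cases hf : f = 0
  · subst hf
    refine le_of_eq_of_le ?_ (sum_nonneg fun _ _ ↦ ind_nonneg _)
    simp [ind]
  · exact (sum_ind_add_ne_zero f hf c).ge

theorem curryLeft_radical_finrank {k : ℕ} (η : V [⋀^Fin (k + 2)]→ₗ[F] F) (u : V) :
    min (finrank F V) (finrank F (radical η) + 1) ≤ finrank F (radical (η.curryLeft u)) := by
  by_cases hu : u ∈ radical η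
  · rw [LinearMap.mem_ker.1 hu]
    have : radical (0 : V [⋀^Fin (k + 1)]→ₗ[F] F) = ⊤ := by
      rw [radical, AlternatingMap.curryLeft_zero, LinearMap.ker_zero]
    rw [this, finrank_top]
    exact min_le_left _ _
  · refine (min_le_right _ _).trans (Submodule.finrank_lt_finrank_of_lt
      (lt_of_le_of_ne (radical_le_radical_curryLeft η u) fun h ↦ hu ?_))
    rw [h]
    exact mem_radical_curryLeft_self η u

variable [Fintype F]

/-- The number of tuples in an `n`-dimensional space on which a fixed decomposable form of
degree `k` does not vanish. -/
noncomputable def minCount (q n k : ℕ) : ℚ :=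
  ∏ j ∈ range k, ((q : ℚ) ^ n - (q : ℚ) ^ (n - 1 - j))

theorem minCount_succ (q n k : ℕ) :
    minCount q n (k + 1) = minCount q n k * ((q : ℚ) ^ n - (q : ℚ) ^ (n - 1 - k)) :=
  prod_range_succ _ _

theorem minCount_pos {q n : ℕ} (hq : 1 < q) (hn : 0 < n) (k : ℕ) : 0 < minCount q n k := by
  refine prod_pos fun j _ ↦ sub_pos.2 ?_
  exact pow_lt_pow_right₀ (by exact_mod_cast hq) (by omega)

theorem sum_ind_mem (S : Submodule F V) :
    ∑ x : V, ind (x ∈ S) = (Fintype.card F : ℚ) ^ finrank F S := by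
  rw [sum_boole, ← Fintype.card_subtype]
  have : Fintype.card {x // x ∈ S} = Fintype.card F ^ finrank F S :=
    Module.card_eq_pow_finrank (K := F) (V := S)
  rw [this]
  push_cast
  rfl

theorem sum_one_eq_pow : ∑ _x : V, (1 : ℚ) = (Fintype.card F : ℚ) ^ finrank F V := by
  rw [sum_const, card_univ, Module.card_eq_pow_finrank (K := F) (V := V)]
  simp

theorem sum_ind_notMem (S : Submodule F V) :
    ∑ x : V, ind (x ∉ S) = (Fintype.card F : ℚ) ^ finrank F V -
      (Fintype.card F : ℚ) ^ finrank F S := by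
  rw [← sum_ind_mem, ← sum_one_eq_pow (F := F) (V := V), ← sum_sub_distrib]
  refine sum_congr rfl fun x _ ↦ ?_
  by_cases h : x ∈ S <;> simp [ind, h]

theorem one_lt_card : (1 : ℚ) < Fintype.card F := by
  exact_mod_cast Fintype.one_lt_card (α := F)

theorem mul_le_nonzeroCount_of_forall {k : ℕ} {c : ℚ}
    (hc : ∀ ξ : V [⋀^Fin k]→ₗ[F] F, ξ ≠ 0 → c ≤ nonzeroCount ξ)
    (η : V [⋀^Fin (k + 1)]→ₗ[F] F) :
    c * ((Fintype.card F : ℚ) ^ finrank F V - (Fintype.card F : ℚ) ^ finrank F (radical η)) ≤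
      nonzeroCount η := by
  rw [nonzeroCount_succ, ← sum_ind_notMem, mul_sum]
  refine sum_le_sum fun x _ ↦ ?_
  by_cases h : x ∈ radical η
  · simp only [ind, not_true_eq_false, h, if_false, mul_zero]
    exact sum_nonneg fun _ _ ↦ ind_nonneg _
  · simp only [ind, h, not_false_eq_true, if_true, mul_one]
    exact hc _ h

/-- A nonzero alternating form is nonzero on at least as many tuples as a decomposable form. -/
theorem minCount_le_nonzeroCount {k : ℕ} (η : V [⋀^Fin k]→ₗ[F] F) (h : η ≠ 0) :
    minCount (Fintype.card F) (finrank F V) k ≤ nonzeroCount η := by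
  induction k with
  | zero =>
    obtain ⟨e, he⟩ := exists_map_ne_zero h
    simp only [minCount, range_zero, prod_empty, nonzeroCount]
    rw [Fintype.sum_eq_single e fun x hx ↦ (hx (Subsingleton.elim _ _)).elim]
    simp [ind, he]
  | succ k ih =>
    refine le_trans ?_ (mul_le_nonzeroCount_of_forall ih η)
    have hr := finrank_radical_add_le h
    have hpos := minCount_pos (Fintype.one_lt_card (α := F)) (n := finrank F V) (by omega) k
    rw [minCount_succ]
    refine mul_le_mul_of_nonneg_left (sub_le_sub_left ?_ _) hpos.le
    exact pow_le_pow_right₀ one_lt_card.le (by omega)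

theorem finrank_radical_of_nonzeroCount_eq {k : ℕ} (η : V [⋀^Fin (k + 1)]→ₗ[F] F)
    (hk : k + 1 ≤ finrank F V)
    (h : nonzeroCount η = minCount (Fintype.card F) (finrank F V) (k + 1)) :
    finrank F V - 1 - k ≤ finrank F (radical η) := by
  have hpos := minCount_pos (Fintype.one_lt_card (α := F)) (n := finrank F V) (by omega) k
  have h1 := mul_le_nonzeroCount_of_forall (fun ξ hξ ↦ minCount_le_nonzeroCount (k := k) ξ hξ) η
  rw [h, minCount_succ] at h1
  have h2 := le_of_mul_le_mul_left h1 hpos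
  exact (pow_le_pow_iff_right₀ (one_lt_card (F := F))).1 (by linarith)

theorem pow_le_sum_ind_forall {k : ℕ} (η : V [⋀^Fin (k + 2)]→ₗ[F] F) (a : Fin k → V) :
    (Fintype.card F : ℚ) ^ min (finrank F V) (finrank F (radical η) + k) ≤
      ∑ y, ind (∀ x, η (Matrix.vecCons x (Matrix.vecCons y a)) = 0) := by
  induction k with
  | zero =>
    rw [add_zero]
    refine le_trans (pow_le_pow_right₀ one_lt_card.le (min_le_right _ _)) ?_
    rw [← sum_ind_mem]
    refine sum_le_sum fun y _ ↦ ind_mono fun hy x ↦ ?_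
    exact map_eq_zero_of_mem_radical (i := 1) (by simpa using hy)
  | succ k ih =>
    refine le_trans (pow_le_pow_right₀ one_lt_card.le ?_)
      ((ih (η.curryLeft (Matrix.vecHead a)) (Matrix.vecTail a)).trans
        (sum_le_sum fun y _ ↦ ind_mono fun hy x ↦ ?_))
    · have := curryLeft_radical_finrank η (Matrix.vecHead a)
      omega
    · have h1 := hy x
      rw [AlternatingMap.curryLeft_apply_apply] at h1
      have h2 : η (Matrix.vecCons x (Matrix.vecCons y a)) =
          (((η.curryLeft x).curryLeft y).curryLeft (Matrix.vecHead a)) (Matrix.vecTail a) := by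
        simp only [AlternatingMap.curryLeft_apply_apply, Matrix.cons_head_tail]
      rw [h2, curryLeft_curryLeft_swap, curryLeft_curryLeft_swap η x]
      simp only [AlternatingMap.neg_apply, AlternatingMap.curryLeft_apply_apply, h1, neg_zero]

end Counting

section Hyperplane

variable {F V} [Fintype V]

/-- The number of tuples annihilated by `ω` on which `η` does not vanish. -/
noncomputable def extraCount {k : ℕ} (ω : V [⋀^Fin (k + 1)]→ₗ[F] F) (η : V [⋀^Fin k]→ₗ[F] F) : ℚ :=
  ∑ a : Fin k → V, ind ((∀ x, ω (Matrix.vecCons x a) = 0) ∧ η a ≠ 0)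

theorem sum_ind_add_curryLeft_ne_zero {k : ℕ} (ω : V [⋀^Fin (k + 1)]→ₗ[F] F)
    (η : V [⋀^Fin k]→ₗ[F] F) :
    ∑ x, ∑ a, ind (ω (Matrix.vecCons x a) + η a ≠ 0) =
      nonzeroCount ω + Fintype.card V * extraCount ω η := by
  rw [nonzeroCount, sum_cons, sum_comm, sum_comm (f := fun x a ↦ ind (ω (Matrix.vecCons x a) ≠ 0)),
    extraCount, mul_sum, ← sum_add_distrib]
  refine sum_congr rfl fun a _ ↦ ?_
  let f : V →ₗ[F] F :=
    { toFun := fun x ↦ ω.curryLeft x a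
      map_add' := fun x y ↦ by simp only [map_add, AlternatingMap.add_apply]
      map_smul' := fun c x ↦ by simp }
  have hf : ∀ x, f x = ω (Matrix.vecCons x a) := fun _ ↦ rfl
  simp only [← hf]
  by_cases h : f = 0
  · simp [h, ind]
  · have h' : ¬ ∀ x, f x = 0 := fun h' ↦ h (LinearMap.ext h')
    simp only [add_comm _ (η a)]
    rw [sum_ind_add_ne_zero f h]
    simp [h', ind]

variable [Fintype F]

theorem sum_eq_sum_sum_add_smul {W : Submodule F V} {v : V} (hv : v ∉ W)
    (hW : finrank F V = finrank F W + 1) {k : ℕ} (f : (Fin k → V) → ℚ) :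
    ∑ a, f a = ∑ t : Fin k → F, ∑ w : Fin k → W, f (fun i ↦ (w i : V) + t i • v) := by
  let g : F × W → V := fun p ↦ (p.2 : V) + p.1 • v
  have hg : Function.Bijective g := by
    rw [Fintype.bijective_iff_injective_and_card]
    constructor
    · rintro ⟨t, w⟩ ⟨t', w'⟩ h
      change (w : V) + t • v = w' + t' • v at h
      have h1 : (t - t') • v = ((w' - w : W) : V) := by
        rw [sub_smul, Submodule.coe_sub, sub_eq_sub_iff_add_eq_add, add_comm, h]
      have h2 : t = t' := by
        by_contra hne
        exact hv ((Submodule.smul_mem_iff W (sub_ne_zero.2 hne)).1 (h1 ▸ (w' - w).2))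
      subst h2
      simpa using h
    · rw [Fintype.card_prod, Module.card_eq_pow_finrank (K := F) (V := V), hW,
        Module.card_eq_pow_finrank (K := F) (V := W), pow_succ, mul_comm]
  rw [← Fintype.sum_prod_type']
  exact (Fintype.sum_equiv ((Equiv.arrowProdEquivProdArrow (Fin k) (fun _ ↦ F) fun _ ↦ W).symm.trans
    ((Equiv.refl (Fin k)).arrowCongr (Equiv.ofBijective g hg))) _ _ fun _ ↦ rfl).symm

theorem nonzeroCount_eq_add {W : Submodule F V} {v : V} (hv : v ∉ W)
    (hW : finrank F V = finrank F W + 1) {k : ℕ} (Φ : V [⋀^Fin (k + 1)]→ₗ[F] F) :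
    nonzeroCount Φ = (Fintype.card F : ℚ) ^ (k + 1) * nonzeroCount (Φ.compLinearMap W.subtype) +
      ((Fintype.card F : ℚ) ^ (k + 1) - 1) * ((Fintype.card F : ℚ) ^ finrank F W *
        extraCount (Φ.compLinearMap W.subtype) ((Φ.curryLeft v).compLinearMap W.subtype)) := by
  set N := nonzeroCount (Φ.compLinearMap W.subtype)
  set E := extraCount (Φ.compLinearMap W.subtype) ((Φ.curryLeft v).compLinearMap W.subtype)
  have h0 : ∑ w : Fin (k + 1) → W, ind (Φ (fun i ↦ (w i : V) + (0 : Fin (k + 1) → F) i • v) ≠ 0) =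
      N := by
    refine sum_congr rfl fun w _ ↦ ?_
    simp
  have h1 : ∑ w : Fin (k + 1) → W,
      ind (Φ (fun i ↦ (w i : V) + (Pi.single 0 1 : Fin (k + 1) → F) i • v) ≠ 0) =
      N + (Fintype.card F : ℚ) ^ finrank F W * E := by
    have := sum_ind_add_curryLeft_ne_zero (Φ.compLinearMap W.subtype)
      ((Φ.curryLeft v).compLinearMap W.subtype)
    rw [Module.card_eq_pow_finrank (K := F) (V := W), Nat.cast_pow] at this
    rw [← this, sum_cons]
    refine sum_congr rfl fun x _ ↦ sum_congr rfl fun a _ ↦ ?_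
    have h2 : (fun i ↦ ((Matrix.vecCons x a i : W) : V) +
        (Pi.single 0 1 : Fin (k + 1) → F) i • v) =
        Matrix.vecCons ((x : V) + v) (fun i ↦ (a i : V)) := by
      ext i
      refine Fin.cases ?_ (fun j ↦ ?_) i <;> simp
    have h3 : (fun i ↦ W.subtype (Matrix.vecCons x a i)) =
        Matrix.vecCons (x : V) (fun i ↦ (a i : V)) := by
      ext i
      refine Fin.cases ?_ (fun j ↦ ?_) i <;> simp
    rw [h2, Φ.map_vecCons_add, AlternatingMap.compLinearMap_apply,
      AlternatingMap.compLinearMap_apply, AlternatingMap.curryLeft_apply_apply]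
    simp only [h3]
    rfl
  have hne : ∀ t : Fin (k + 1) → F, t ≠ 0 →
      ∑ w : Fin (k + 1) → W, ind (Φ (fun i ↦ (w i : V) + t i • v) ≠ 0) =
        N + (Fintype.card F : ℚ) ^ finrank F W * E := by
    intro t ht
    rw [← h1]
    refine sum_eq_sum_single (fun t (w : Fin (k + 1) → W) ↦ Φ (fun i ↦ (w i : V) + t i • v) ≠ 0)
      (fun M hM t (a : Fin (k + 1) → W) ↦ ?_) ht
    have : (fun i ↦ ((tupleAct M a i : W) : V) + (M *ᵥ t) i • v) =
        tupleAct M (fun i ↦ (a i : V) + t i • v) := by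
      rw [tupleAct_add_smul]
      simp [tupleAct]
    rw [this, map_tupleAct]
    simp [hM]
  rw [nonzeroCount, sum_eq_sum_sum_add_smul hv hW, ← add_sum_erase univ _ (mem_univ 0), h0,
    sum_congr rfl fun t ht ↦ hne t (ne_of_mem_erase ht), sum_const, card_erase_of_mem (mem_univ _),
    card_univ, Fintype.card_fun, Fintype.card_fin, nsmul_eq_mul, Nat.cast_sub
      (Nat.one_le_pow _ _ Fintype.card_pos)]
  push_cast
  ring

end Hyperplane

section ExtraCount

variable {F V} [Fintype F] [Fintype V]

theorem pow_sub_one_mul_le_extraCount {k : ℕ} (ω : V [⋀^Fin (k + 2)]→ₗ[F] F)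
    (η : V [⋀^Fin (k + 1)]→ₗ[F] F) {u : V} (hu : u ∈ radical ω) (hη : η.curryLeft u ≠ 0)
    (hdim : finrank F V ≤ finrank F (radical ω) + k + 2) :
    ((Fintype.card F : ℚ) ^ (k + 1) - 1) * ((Fintype.card F : ℚ) ^ (finrank F V - 2) *
      minCount (Fintype.card F) (finrank F V) k) ≤
      (Fintype.card F : ℚ) ^ (k + 1) * extraCount ω η := by
  let X : (Fin (k + 1) → V) → Prop := fun a ↦ ∀ x, ω (Matrix.vecCons x a) = 0
  have hXadd : ∀ a (s : Fin (k + 1) → F), X (fun i ↦ a i + s i • u) ↔ X a := by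
    refine fun a s ↦ forall_congr' fun x ↦ ?_
    have h := map_add_of_mem_radical ω (Matrix.vecCons x a) (Matrix.vecCons 0 fun i ↦ s i • u)
      (Fin.cases (zero_mem _) fun i ↦ Submodule.smul_mem _ _ hu)
    rw [Matrix.cons_add_cons, add_zero] at h
    rw [← h]
    rfl
  have hXact : ∀ (M : Matrix (Fin (k + 1)) (Fin (k + 1)) F), M.det ≠ 0 → ∀ a,
      X (tupleAct M a) ↔ X a := by
    refine fun M hM a ↦ forall_congr' fun x ↦ ?_
    rw [← AlternatingMap.curryLeft_apply_apply, map_tupleAct]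
    simp [hM]
  let P : (Fin (k + 1) → F) → (Fin (k + 1) → V) → Prop := fun s a ↦
    X a ∧ η (fun i ↦ a i + s i • u) - η a ≠ 0
  have hP : ∀ (M : Matrix (Fin (k + 1)) (Fin (k + 1)) F), M.det ≠ 0 → ∀ s a,
      P (M *ᵥ s) (tupleAct M a) ↔ P s a := by
    intro M hM s a
    simp only [P, hXact M hM, ← tupleAct_add_smul, map_tupleAct, ← mul_sub]
    simp [hM]
  have htranslate : ∀ s : Fin (k + 1) → F,
      ∑ a, ind (X a ∧ η (fun i ↦ a i + s i • u) ≠ 0) = extraCount ω η := by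
    intro s
    refine Eq.trans (sum_congr rfl fun a _ ↦ ?_)
      (Equiv.sum_comp (Equiv.addRight fun i ↦ s i • u) fun a ↦ ind (X a ∧ η a ≠ 0))
    rw [← hXadd a s]
    rfl
  have hcard : ∑ _s : Fin (k + 1) → F, (1 : ℚ) = (Fintype.card F : ℚ) ^ (k + 1) := by
    rw [sum_one_eq_pow (F := F), finrank_fin_fun]
  have hsingle : (Fintype.card F : ℚ) ^ (finrank F V - 2) *
      minCount (Fintype.card F) (finrank F V) k ≤ ∑ a, ind (P (Pi.single 0 1) a) := by
    rw [sum_cons, sum_comm]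
    refine (mul_le_mul_of_nonneg_left (minCount_le_nonzeroCount _ hη) (by positivity)).trans ?_
    rw [nonzeroCount, mul_sum]
    refine sum_le_sum fun a _ ↦ ?_
    have hPa : ∀ x, P (Pi.single 0 1) (Matrix.vecCons x a) ↔
        X (Matrix.vecCons x a) ∧ η.curryLeft u a ≠ 0 := by
      intro x
      have h : (fun i ↦ Matrix.vecCons x a i + (Pi.single 0 1 : Fin (k + 1) → F) i • u) =
          Matrix.vecCons (x + u) a := by
        ext i
        refine Fin.cases ?_ (fun j ↦ ?_) i <;> simp
      simp only [P, h, η.map_vecCons_add, add_sub_cancel_left, AlternatingMap.curryLeft_apply_apply]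
    simp only [hPa]
    by_cases h : η.curryLeft u a = 0
    · simp [h, ind]
    · simp only [h, ne_eq, not_false_eq_true, and_true]
      rw [show ind True = 1 from if_pos trivial, mul_one]
      refine le_trans (pow_le_pow_right₀ one_lt_card.le ?_) (pow_le_sum_ind_forall ω a)
      omega
  have hle : ∀ a, ∑ s, ind (P s a) ≤ ∑ s : Fin (k + 1) → F,
      ind (X a ∧ η (fun i ↦ a i + s i • u) ≠ 0) := by
    intro a
    by_cases hX : X a
    · obtain ⟨h, hh⟩ := exists_linear_map_add_smul η a u
      simpa only [P, hX, true_and, hh, add_sub_cancel_left] using sum_ind_ne_zero_le h (η a)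
    · simp [P, hX, ind]
  calc
    _ ≤ ((Fintype.card F : ℚ) ^ (k + 1) - 1) * ∑ a, ind (P (Pi.single 0 1) a) :=
      mul_le_mul_of_nonneg_left hsingle (sub_nonneg.2 (one_le_pow₀ one_lt_card.le))
    _ = ∑ s ∈ univ.erase (0 : Fin (k + 1) → F), ∑ a, ind (P s a) := by
      rw [sum_congr rfl fun s hs ↦ sum_eq_sum_single P hP (ne_of_mem_erase hs), ← hcard,
        ← add_sum_erase univ _ (mem_univ 0), add_sub_cancel_left, sum_mul]
      simp only [one_mul]
    _ ≤ ∑ s, ∑ a, ind (P s a) :=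
      sum_le_sum_of_subset_of_nonneg (erase_subset _ _) fun _ _ _ ↦
        sum_nonneg fun _ _ ↦ ind_nonneg _
    _ = ∑ a, ∑ s, ind (P s a) := sum_comm
    _ ≤ ∑ a, ∑ s : Fin (k + 1) → F, ind (X a ∧ η (fun i ↦ a i + s i • u) ≠ 0) :=
      sum_le_sum fun a _ ↦ hle a
    _ = _ := by
      rw [sum_comm, sum_congr rfl fun s _ ↦ htranslate s, ← hcard, sum_mul]
      simp only [one_mul]

end ExtraCount

section LowerBound

variable {F V}

theorem eq_zero_of_mem_radical_of_restrict {k : ℕ} {ξ : V [⋀^Fin (k + 1)]→ₗ[F] F}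
    {W : Submodule F V} {v : V} (htop : W ⊔ Submodule.span F {v} = ⊤) (hv : v ∈ radical ξ)
    (hW : ∀ w : Fin (k + 1) → W, ξ (fun i ↦ (w i : V)) = 0) : ξ = 0 := by
  refine AlternatingMap.ext fun a ↦ ?_
  have h : ∀ i, ∃ (w : W) (t : F), (w : V) + t • v = a i := by
    intro i
    obtain ⟨w, hw, y, hy, h⟩ := Submodule.mem_sup.1 (htop ▸ Submodule.mem_top : a i ∈ _)
    obtain ⟨t, rfl⟩ := Submodule.mem_span_singleton.1 hy
    exact ⟨⟨w, hw⟩, t, h⟩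
  choose w t h using h
  have ha : a = (fun i ↦ (w i : V)) + fun i ↦ t i • v := funext fun i ↦ (h i).symm
  rw [ha, map_add_of_mem_radical ξ _ _ fun i ↦ Submodule.smul_mem _ _ hv, hW]
  rfl

theorem coe_mem_radical {k : ℕ} (Φ : V [⋀^Fin (k + 2)]→ₗ[F] F) {W : Submodule F V} {v : V}
    (htop : W ⊔ Submodule.span F {v} = ⊤) {u : W}
    (hu : u ∈ radical (Φ.compLinearMap W.subtype))
    (hη : ((Φ.curryLeft v).compLinearMap W.subtype).curryLeft u = 0) :
    (u : V) ∈ radical Φ := by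
  rw [LinearMap.mem_ker]
  refine eq_zero_of_mem_radical_of_restrict htop ?_ fun w ↦ ?_
  · have hη' : ∀ w : Fin k → W, ((Φ.curryLeft u).curryLeft v) (fun i ↦ (w i : V)) = 0 := by
      intro w
      rw [curryLeft_curryLeft_swap, AlternatingMap.neg_apply, neg_eq_zero]
      rw [AlternatingMap.curryLeft_compLinearMap] at hη
      exact congrArg (fun θ ↦ θ w) hη
    rw [LinearMap.mem_ker]
    cases k with
    | zero =>
      refine AlternatingMap.ext fun a ↦ ?_
      rw [Subsingleton.elim a fun i ↦ ((0 : Fin 0 → W) i : V), hη']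
      rfl
    | succ k => exact eq_zero_of_mem_radical_of_restrict htop (mem_radical_curryLeft_self _ v) hη'
  · simpa using congrArg (fun θ ↦ θ w) (LinearMap.mem_ker.1 hu)

theorem sup_span_singleton_eq_top [FiniteDimensional F V] {W : Submodule F V} {v : V} (hv : v ∉ W)
    (hW : finrank F V = finrank F W + 1) : W ⊔ Submodule.span F {v} = ⊤ := by
  refine Submodule.eq_top_of_finrank_eq (le_antisymm (Submodule.finrank_le _) ?_)
  rw [hW]
  refine Submodule.finrank_lt_finrank_of_lt (lt_of_le_of_ne le_sup_left fun h ↦ hv ?_)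
  rw [h]
  exact Submodule.mem_sup_right (Submodule.mem_span_singleton_self v)

variable [Fintype F] [Fintype V]

theorem minCount_succ_left (q : ℕ) {n k : ℕ} (h : k ≤ n) :
    minCount q (n + 1) k = (q : ℚ) ^ k * minCount q n k := by
  rw [minCount, minCount, ← card_range k, ← prod_const, card_range, ← prod_mul_distrib]
  refine prod_congr rfl fun j hj ↦ ?_
  have : n + 1 - 1 - j = n - 1 - j + 1 := by have := mem_range.1 hj; omega
  rw [this]
  ring

/-- A nondecomposable form whose restriction to a hyperplane has the least possible number of
nonzeros has at least `1 + q⁻²` times as many nonzeros as a decomposable form. -/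
theorem minCount_mul_le_nonzeroCount {n k : ℕ} (hV : finrank F V = n + 1) (hk : k + 2 ≤ n)
    (φ : ⋀[F]^(k + 2) V →ₗ[F] F) (hφ : φ ≠ 0)
    (hnd : ¬ IsDecomposable F V (n + 1) (k + 2) (by omega) φ)
    (W : Submodule F V) (hW : finrank F W = n)
    (hmin : nonzeroCount ((formOf φ).compLinearMap W.subtype) =
      minCount (Fintype.card F) n (k + 2)) :
    minCount (Fintype.card F) (n + 1) (k + 2) * ((Fintype.card F : ℚ) ^ 2 + 1) ≤
      (Fintype.card F : ℚ) ^ 2 * nonzeroCount (formOf φ) := by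
  obtain ⟨v, hv⟩ : ∃ v, v ∉ W := by
    by_contra! h
    rw [(Submodule.eq_top_iff').2 h, finrank_top] at hW
    omega
  have hVW : finrank F V = finrank F W + 1 := by rw [hV, hW]
  set ω := (formOf φ).compLinearMap W.subtype with hω
  set η := ((formOf φ).curryLeft v).compLinearMap W.subtype with hη
  have hrad : n - 1 - (k + 1) ≤ finrank F (radical ω) := by
    have := finrank_radical_of_nonzeroCount_eq ω (by omega) (by rw [hmin, hW])
    rwa [hW] at this
  obtain ⟨u, hu, hηu⟩ : ∃ u ∈ radical ω, η.curryLeft u ≠ 0 := by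
    by_contra! h
    obtain ⟨e, he⟩ := exists_map_ne_zero (formOf_ne_zero hφ)
    refine hnd (isDecomposable_of_ker_updateMap_le hV (by omega) φ he
      (ker_updateMap_le_radical he ((radical ω).map W.subtype) ?_ ?_))
    · rintro _ ⟨u, hu, rfl⟩
      exact coe_mem_radical _ (sup_span_singleton_eq_top hv hVW) hu (h u hu)
    · rw [(Submodule.equivMapOfInjective _ W.injective_subtype _).finrank_eq.symm]
      omega
  have hE := pow_sub_one_mul_le_extraCount ω η hu hηu (by omega)
  have hmain := nonzeroCount_eq_add hv hVW (formOf φ)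
  rw [← hω, ← hη, hmin] at hmain
  rw [hmain, minCount_succ_left _ hk]
  rw [hW] at hE ⊢
  obtain ⟨c, rfl⟩ := Nat.exists_eq_add_of_le hk
  rw [minCount_succ, minCount_succ]
  have e1 : k + 2 + c - 2 = c + k := by omega
  have e2 : k + 2 + c - 1 - k = c + 1 := by omega
  have e3 : k + 2 + c - 1 - (k + 1) = c := by omega
  rw [e1] at hE
  rw [e2, e3]
  have hQ := one_lt_card (F := F)
  set Q : ℚ := (Fintype.card F : ℚ)
  set A := minCount (Fintype.card F) (k + 2 + c) k
  set E := extraCount ω η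
  have hfac : 0 ≤ (Q ^ (k + 2) - 1) * Q ^ (c + 3) :=
    mul_nonneg (sub_nonneg.2 (one_le_pow₀ hQ.le)) (by positivity)
  have := mul_le_mul_of_nonneg_left hE hfac
  simp only [pow_add] at this ⊢
  linarith

end LowerBound

section Subspaces

variable {F V}

/-- The number of ordered bases of an `l`-dimensional space over a field with `q` elements. -/
noncomputable def basisCount (q l : ℕ) : ℚ := ∏ i ∈ range l, ((q : ℚ) ^ l - (q : ℚ) ^ i)

theorem basisCount_pos {q : ℕ} (hq : 1 < q) (l : ℕ) : 0 < basisCount q l :=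
  prod_pos fun _ hi ↦ sub_pos.2 (pow_lt_pow_right₀ (by exact_mod_cast hq) (mem_range.1 hi))

theorem gaussBinom_mul_basisCount {q n l : ℕ} (hq : 1 < q) (h : l ≤ n) :
    basisCount q l * gaussBinom q n l = ∏ i ∈ range l, ((q : ℚ) ^ n - (q : ℚ) ^ i) := by
  have hq' : (1 : ℚ) < q := by exact_mod_cast hq
  have h1 : ∀ N, l ≤ N → ∏ i ∈ range l, ((q : ℚ) ^ N - (q : ℚ) ^ i) =
      (∏ i ∈ range l, (q : ℚ) ^ i) * ∏ i ∈ range l, ((q : ℚ) ^ (N - i) - 1) := by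
    intro N hN
    rw [← prod_mul_distrib]
    refine prod_congr rfl fun i hi ↦ ?_
    rw [mul_sub, ← pow_add, Nat.add_sub_cancel' ((mem_range.1 hi).le.trans hN), mul_one]
  have h2 : ∏ i ∈ range l, ((q : ℚ) ^ (l - i) - 1) = ∏ i ∈ range l, ((q : ℚ) ^ (i + 1) - 1) := by
    rw [← prod_range_reflect]
    refine prod_congr rfl fun i hi ↦ ?_
    have : l - (l - 1 - i) = i + 1 := by have := mem_range.1 hi; omega
    rw [this]
  have h3 : ∏ i ∈ range l, ((q : ℚ) ^ (i + 1) - 1) ≠ 0 :=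
    prod_ne_zero_iff.2 fun i _ ↦ (sub_pos.2 (one_lt_pow₀ hq' i.succ_ne_zero)).ne'
  rw [basisCount, gaussBinom, h1 l le_rfl, h1 n h, h2, prod_div_distrib]
  field_simp

theorem basisCount_mul_pow {q n l : ℕ} (h : l ≤ n) :
    basisCount q l * (q : ℚ) ^ (l * (n - l)) = minCount q n l := by
  have hpow : (q : ℚ) ^ (l * (n - l)) = ∏ _i ∈ range l, (q : ℚ) ^ (n - l) := by
    rw [prod_const, card_range, mul_comm, pow_mul]
  rw [basisCount, minCount, ← prod_range_reflect, hpow, ← prod_mul_distrib]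
  refine prod_congr rfl fun i hi ↦ ?_
  have := mem_range.1 hi
  rw [sub_mul, ← pow_add, ← pow_add]
  congr 2 <;> omega

theorem natCast_card_subtype {α : Type*} [Fintype α] (P : α → Prop) :
    (Nat.card {a // P a} : ℚ) = ∑ a, ind (P a) := by
  rw [sum_boole, Nat.card_eq_fintype_card, Fintype.card_subtype]

theorem map_eq_zero_of_liesOn {l : ℕ} {φ : ⋀[F]^l V →ₗ[F] F} {L : Submodule F V}
    (h : LiesOn F V l φ L) {b : Fin l → V} (hb : ∀ i, b i ∈ L) : formOf φ b = 0 := by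
  obtain ⟨e, -, -, hspan, he⟩ := h
  exact map_eq_zero_of_map_eq_zero (formOf φ) e b (fun i ↦ hspan ▸ hb i) he

variable [Fintype V]

theorem nonzeroCount_compLinearMap_top {l : ℕ} (η : V [⋀^Fin l]→ₗ[F] F) :
    nonzeroCount (η.compLinearMap (⊤ : Submodule F V).subtype) = nonzeroCount η :=
  Fintype.sum_equiv ((Equiv.refl (Fin l)).arrowCongr Submodule.topEquiv.toEquiv) _ _ fun _ ↦ rfl

variable [Fintype F]

theorem natCast_card_linearIndependent {l : ℕ} (h : l ≤ finrank F V) :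
    (Nat.card {s : Fin l → V // LinearIndependent F s} : ℚ) =
      ∏ i ∈ range l, ((Fintype.card F : ℚ) ^ finrank F V - (Fintype.card F : ℚ) ^ i) := by
  rw [card_linearIndependent h, Nat.cast_prod,
    ← Fin.prod_univ_eq_prod_range (fun i ↦ (Fintype.card F : ℚ) ^ finrank F V -
      (Fintype.card F : ℚ) ^ i)]
  refine prod_congr rfl fun i _ ↦ ?_
  rw [Nat.cast_sub (Nat.pow_le_pow_right Fintype.card_pos (i.2.le.trans h))]
  push_cast
  rfl

theorem natCast_card_linearIndependent_and_map_eq_zero {l : ℕ} (η : V [⋀^Fin l]→ₗ[F] F)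
    (h : l ≤ finrank F V) :
    (Nat.card {s : Fin l → V // LinearIndependent F s ∧ η s = 0} : ℚ) =
      ∏ i ∈ range l, ((Fintype.card F : ℚ) ^ finrank F V - (Fintype.card F : ℚ) ^ i) -
        nonzeroCount η := by
  rw [← natCast_card_linearIndependent h, natCast_card_subtype, natCast_card_subtype, nonzeroCount,
    ← sum_sub_distrib]
  refine sum_congr rfl fun a _ ↦ ?_
  by_cases ha : η a = 0
  · simp [ha, ind]
  · simp [ha, linearIndependent_of_map_ne_zero η a ha, ind]

/-- Subspaces lying on a hyperplane of the Plücker space are counted by their ordered bases. -/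
theorem basisCount_mul_card_liesOn_eq_card {l : ℕ} (φ : ⋀[F]^l V →ₗ[F] F)
    (W : Submodule F V) :
    basisCount (Fintype.card F) l *
      Nat.card {L : Submodule F V | finrank F L = l ∧ L ≤ W ∧ LiesOn F V l φ L} =
      Nat.card {s : Fin l → W // LinearIndependent F s ∧
        (formOf φ).compLinearMap W.subtype s = 0} := by
  let S := {L : Submodule F V | finrank F L = l ∧ L ≤ W ∧ LiesOn F V l φ L}
  let f : (Σ L : S, {s : Fin l → (L : Submodule F V) // LinearIndependent F s}) →
      {s : Fin l → W // LinearIndependent F s ∧ (formOf φ).compLinearMap W.subtype s = 0} :=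
    fun p ↦ ⟨fun i ↦ Submodule.inclusion p.1.2.2.1 (p.2.1 i),
      p.2.2.map' (Submodule.inclusion p.1.2.2.1) (Submodule.ker_inclusion _ _ _),
      map_eq_zero_of_liesOn p.1.2.2.2 fun i ↦ (p.2.1 i).2⟩
  have hf : Function.Bijective f := by
    constructor
    · rintro ⟨⟨L, hL⟩, s, hs⟩ ⟨⟨L', hL'⟩, s', hs'⟩ h
      have hval : ∀ i, (s i : V) = s' i := fun i ↦
        congrArg (fun p ↦ ((p.1 i : W) : V)) h
      have hspan : ∀ (L : Submodule F V), finrank F L = l → ∀ s : Fin l → L,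
          LinearIndependent F s → Submodule.span F (Set.range fun i ↦ (s i : V)) = L := by
        intro L hL s hs
        refine Submodule.eq_of_le_of_finrank_eq
          (Submodule.span_le.2 (Set.range_subset_iff.2 fun i ↦ (s i).2)) ?_
        have hs' : LinearIndependent F fun i ↦ (s i : V) := hs.map' L.subtype L.ker_subtype
        rw [finrank_span_eq_card hs', Fintype.card_fin, hL]
      obtain rfl : L = L' := by
        rw [← hspan L hL.1 s hs, ← hspan L' hL'.1 s' hs']
        simp only [hval]
      obtain rfl : s = s' := funext fun i ↦ Subtype.ext (hval i)
      rfl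
    · rintro ⟨s, hs, hs0⟩
      have hs' : LinearIndependent F fun i ↦ (s i : V) := hs.map' W.subtype W.ker_subtype
      have hmem : ∀ i, (s i : V) ∈ Submodule.span F (Set.range fun i ↦ (s i : V)) := fun i ↦
        Submodule.subset_span ⟨i, rfl⟩
      refine ⟨⟨⟨Submodule.span F (Set.range fun i ↦ (s i : V)), ?_, ?_, ?_⟩,
        fun i ↦ ⟨s i, hmem i⟩, ?_⟩, rfl⟩
      · rw [finrank_span_eq_card hs', Fintype.card_fin]
      · exact Submodule.span_le.2 (Set.range_subset_iff.2 fun i ↦ (s i).2)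
      · exact ⟨_, hmem, hs', rfl, hs0⟩
      · exact LinearIndependent.of_comp (Submodule.subtype _) hs'
  have : Fintype S := Fintype.ofFinite _
  rw [← Nat.card_eq_of_bijective f hf, Nat.card_sigma, Nat.cast_sum]
  have hfib : ∀ L : S, (Nat.card {s : Fin l → (L : Submodule F V) // LinearIndependent F s} : ℚ) =
      basisCount (Fintype.card F) l := by
    intro L
    rw [natCast_card_linearIndependent L.2.1.ge, L.2.1, basisCount]
  rw [sum_congr rfl fun L _ ↦ hfib L, sum_const, card_univ, ← Nat.card_eq_fintype_card (α := S),
    nsmul_eq_mul, mul_comm]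

theorem basisCount_mul_card_liesOn {l : ℕ} (φ : ⋀[F]^l V →ₗ[F] F) (W : Submodule F V)
    (h : l ≤ finrank F W) :
    basisCount (Fintype.card F) l *
      Nat.card {L : Submodule F V | finrank F L = l ∧ L ≤ W ∧ LiesOn F V l φ L} =
      basisCount (Fintype.card F) l * gaussBinom (Fintype.card F) (finrank F W) l -
        nonzeroCount ((formOf φ).compLinearMap W.subtype) := by
  rw [basisCount_mul_card_liesOn_eq_card, natCast_card_linearIndependent_and_map_eq_zero _ h,
    gaussBinom_mul_basisCount Fintype.one_lt_card h]

end Subspaces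

end PluckerHyperplane

/-- Let `2 ≤ ℓ ≤ m−2` and let `Π` be a nondecomposable hyperplane of `P(⋀^ℓ V)` such that
`|{L ∈ G(ℓ,W) : L lies on Π}| = e(ℓ,m−1)` for some `(m−1)`-dimensional subspace `W` of `V`.
Then `|Π ∩ G(ℓ,V)| ≤ e'(ℓ,m)`. -/
theorem stmt15 (F : Type*) [Field F] [Fintype F] (V : Type*) [AddCommGroup V] [Module F V]
    [FiniteDimensional F V] (q m l : ℕ) (hq : Fintype.card F = q)
    (hV : finrank F V = m) (hl : 2 ≤ l) (hlm : l ≤ m - 2)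
    (φ : ⋀[F]^l V →ₗ[F] F) (hφ : φ ≠ 0)
    (hnd : ¬ IsDecomposable F V m l (by omega) φ)
    (W : Submodule F V) (hW : finrank F W = m - 1)
    (hcard : (Nat.card {L : Submodule F V | finrank F L = l ∧ L ≤ W ∧ LiesOn F V l φ L} : ℚ)
      = eG q l (m - 1)) :
    (Nat.card {L : Submodule F V | finrank F L = l ∧ LiesOn F V l φ L} : ℚ) ≤
      eG' q l m := by
  classical
  have : Finite V := Module.finite_of_finite F
  have : Fintype V := Fintype.ofFinite V
  obtain ⟨k, rfl⟩ := Nat.exists_eq_add_of_le' hl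
  obtain ⟨n, rfl⟩ : ∃ n, m = n + 1 := ⟨m - 1, by omega⟩
  rw [Nat.add_sub_cancel] at hW hcard
  subst hq
  have hg := PluckerHyperplane.basisCount_pos (Fintype.one_lt_card (α := F)) (k + 2)
  have hcountW := PluckerHyperplane.basisCount_mul_card_liesOn φ W (by omega)
  have hcountV := PluckerHyperplane.basisCount_mul_card_liesOn φ ⊤ (by rw [finrank_top]; omega)
  rw [PluckerHyperplane.nonzeroCount_compLinearMap_top, finrank_top, hV] at hcountV
  simp only [le_top, true_and] at hcountV
  rw [hcard, hW, eG, mul_sub, PluckerHyperplane.basisCount_mul_pow (by omega)] at hcountW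
  have hmain := PluckerHyperplane.minCount_mul_le_nonzeroCount hV (by omega) φ hφ hnd W hW
    (by linarith)
  rw [← PluckerHyperplane.basisCount_mul_pow (by omega)] at hmain
  have hexp : 2 ≤ (k + 2) * (n + 1 - (k + 2)) :=
    Nat.le_trans (by omega) (Nat.le_mul_of_pos_right (k + 2) (by omega))
  obtain ⟨e, he⟩ := Nat.exists_eq_add_of_le' hexp
  refine le_of_mul_le_mul_left ?_ hg
  rw [hcountV, eG', he, Nat.add_sub_cancel]
  rw [he, pow_add] at hmain
  have hQ : (0 : ℚ) < (Fintype.card F : ℚ) ^ 2 := by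
    have := Fintype.card_pos (α := F)
    positivity
  have := le_of_mul_le_mul_left (hmain.trans' (le_of_eq (by ring)) :
    (Fintype.card F : ℚ) ^ 2 * (PluckerHyperplane.basisCount (Fintype.card F) (k + 2) *
      ((Fintype.card F : ℚ) ^ e * (Fintype.card F : ℚ) ^ 2 + (Fintype.card F : ℚ) ^ e)) ≤ _) hQ
  rw [pow_add]
  linarith
end

section
/- Let V have dimension m = 4 and let Π be a hyperplane of the Plücker projective space P(⋀^2 V) that is not decomposable. Then |Π ∩ G(2,V)| = q^3 + q^2 + q + 1. -/
open Module

variable (F : Type*) [Field F] (V : Type*) [AddCommGroup V] [Module F V]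

/-- The bilinear form `(v, w) ↦ φ (v ∧ w)` attached to a functional on the exterior square. -/
noncomputable def wedgeForm {F : Type*} [Field F] {V : Type*} [AddCommGroup V] [Module F V]
    (φ : ⋀[F]^2 V →ₗ[F] F) : V →ₗ[F] V →ₗ[F] F :=
  have h0 : ∀ v w x : V, Function.update ![v, w] 0 x = ![x, w] := fun v w x => by
    ext i; fin_cases i <;> rfl
  have h1 : ∀ v w x : V, Function.update ![v, w] 1 x = ![v, x] := fun v w x => by
    ext i; fin_cases i <;> rfl
  LinearMap.mk₂ F (fun v w => φ (exteriorPower.ιMulti F 2 ![v, w]))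
    (fun v v' w => by
      simpa only [h0, map_add] using
        congrArg φ ((exteriorPower.ιMulti F 2 (M := V)).map_update_add ![v, w] 0 v v'))
    (fun c v w => by
      simpa only [h0, map_smul] using
        congrArg φ ((exteriorPower.ιMulti F 2 (M := V)).map_update_smul ![v, w] 0 c v))
    (fun v w w' => by
      simpa only [h1, map_add] using
        congrArg φ ((exteriorPower.ιMulti F 2 (M := V)).map_update_add ![v, w] 1 w w'))
    (fun c v w => by
      simpa only [h1, map_smul] using
        congrArg φ ((exteriorPower.ιMulti F 2 (M := V)).map_update_smul ![v, w] 1 c w))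

theorem wedgeForm_apply {F : Type*} [Field F] {V : Type*} [AddCommGroup V] [Module F V]
    (φ : ⋀[F]^2 V →ₗ[F] F) (v w : V) :
    wedgeForm φ v w = φ (exteriorPower.ιMulti F 2 ![v, w]) := rfl

theorem wedgeForm_isAlt {F : Type*} [Field F] {V : Type*} [AddCommGroup V] [Module F V]
    (φ : ⋀[F]^2 V →ₗ[F] F) : (wedgeForm φ).IsAlt := fun v => by
  rw [wedgeForm_apply, AlternatingMap.map_eq_zero_of_eq _ _ (i := 0) (j := 1) rfl (by decide),
    map_zero]

theorem LinearMap.IsAlt.apply_eq_zero_of_mem_span_range {F : Type*} [Field F] {V : Type*}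
    [AddCommGroup V] [Module F V] {B : V →ₗ[F] V →ₗ[F] F} (hB : B.IsAlt) {ω : Fin 2 → V}
    (h : B (ω 0) (ω 1) = 0) :
    ∀ x ∈ Submodule.span F (Set.range ω), ∀ y ∈ Submodule.span F (Set.range ω), B x y = 0 := by
  intro x hx y hy
  have hr : Set.range ω = {ω 0, ω 1} := by
    ext; simp [Fin.exists_fin_two, eq_comm]
  rw [hr, Submodule.mem_span_pair] at hx hy
  obtain ⟨a, b, rfl⟩ := hx
  obtain ⟨c, d, rfl⟩ := hy
  have h' := hB.neg (ω 0) (ω 1)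
  rw [h, neg_zero] at h'
  simp [h, ← h', hB.self_eq_zero]

theorem liesOn_two_iff {F : Type*} [Field F] {V : Type*} [AddCommGroup V] [Module F V]
    (φ : ⋀[F]^2 V →ₗ[F] F) (L : Submodule F V) (hL : finrank F L = 2) :
    LiesOn F V 2 φ L ↔ ∀ x ∈ L, ∀ y ∈ L, wedgeForm φ x y = 0 := by
  have hw : ∀ ω : Fin 2 → V, φ (wedge F V 2 ω) = wedgeForm φ (ω 0) (ω 1) := fun ω => by
    rw [wedgeForm_apply, ← List.ofFn_inj.1 (show List.ofFn ω = List.ofFn ![ω 0, ω 1] by simp)]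
    rfl
  constructor
  · rintro ⟨ω, -, -, rfl, h⟩
    exact (wedgeForm_isAlt φ).apply_eq_zero_of_mem_span_range (by rwa [hw] at h)
  · intro h
    have : FiniteDimensional F L := FiniteDimensional.of_finrank_pos (by omega)
    let b := finBasisOfFinrankEq F L hL
    refine ⟨fun i => b i, fun i => (b i).2,
      b.linearIndependent.map' L.subtype L.ker_subtype, ?_, ?_⟩
    · have := congrArg (Submodule.map L.subtype) b.span_eq
      rwa [Submodule.map_span, ← Set.range_comp, Submodule.map_top, L.range_subtype] at this
    · rw [hw]
      exact h _ (b 0).2 _ (b 1).2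

theorem det_fin_four_of_col_zero {R : Type*} [CommRing R] (A : Matrix (Fin 4) (Fin 4) R)
    (h : A 0 0 = 1) (h' : ∀ i : Fin 3, A i.succ 0 = 0) :
    A.det = A 1 1 * (A 2 2 * A 3 3 - A 3 2 * A 2 3) - A 2 1 * (A 1 2 * A 3 3 - A 3 2 * A 1 3) +
      A 3 1 * (A 1 2 * A 2 3 - A 2 2 * A 1 3) := by
  rw [Matrix.det_succ_column_zero, Fin.sum_univ_succ]
  simp only [h, h', Matrix.det_fin_three]
  simp
  ring

theorem isDecomposable_of_wedgeForm_eq_zero {F : Type*} [Field F] {V : Type*} [AddCommGroup V]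
    [Module F V] [FiniteDimensional F V] (hV : finrank F V = 4) (φ : ⋀[F]^2 V →ₗ[F] F)
    {u : V} (hu : u ≠ 0) (h : wedgeForm φ u = 0) : IsDecomposable F V 4 2 (by omega) φ := by
  obtain ⟨e, he⟩ : ∃ e : Basis (Fin 4) F V, e 0 = u := by
    let b := Basis.extend (K := F) (LinearIndepOn.singleton (i := u) (v := id) hu)
    have : Fintype (LinearIndepOn.extend (LinearIndepOn.singleton (R := F) (i := u) (v := id) hu)
      (Set.subset_univ _)) := FiniteDimensional.fintypeBasisIndex b
    obtain ⟨i, hi⟩ : ∃ i, b i = u :=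
      ⟨⟨u, LinearIndepOn.subset_extend _ _ rfl⟩, by simp [b]⟩
    let f := Fintype.equivFinOfCardEq ((finrank_eq_card_basis b).symm.trans hV)
    refine ⟨b.reindex (f.trans (Equiv.swap (f i) 0)), ?_⟩
    simp [Basis.reindex_apply, hi]
  let w : V := wedgeForm φ (e 2) (e 3) • e 1 + wedgeForm φ (e 3) (e 1) • e 2 +
    wedgeForm φ (e 1) (e 2) • e 3
  have hψ : ∀ v : Fin 4 → V,
      exteriorPower.alternatingMapLinearEquiv e.det (exteriorPower.ιMulti F 4 v) = e.det v :=
    fun v => by simp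
  refine ⟨![u, w], exteriorPower.alternatingMapLinearEquiv e.det, fun h0 => ?_, fun x => ?_⟩
  · have := hψ e
    rw [h0, e.det_self] at this
    simp at this
  let M : ⋀[F]^2 V →ₗ[F] ⋀[F]^4 V :=
    { toFun := mulWedge F V 2 2 4 rfl ![u, w]
      map_add' := fun x y => Subtype.ext (mul_add _ _ _)
      map_smul' := fun c x => Subtype.ext (mul_smul_comm _ _ _) }
  suffices φ = exteriorPower.alternatingMapLinearEquiv e.det ∘ₗ M from congrArg (fun f => f x) this
  have hM : ∀ v : Fin 2 → V, M (exteriorPower.ιMulti F 2 v) =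
      exteriorPower.ιMulti F 4 ![u, w, v 0, v 1] := fun v => Subtype.ext <| by
    simp [M, mulWedge, ExteriorAlgebra.ιMulti_apply, mul_assoc, Matrix.vecTail]
  have h0 : ∀ y, wedgeForm φ (e 0) y = 0 := by simp [he, h]
  have h1 : ∀ y, wedgeForm φ y (e 0) = 0 := fun y => by
    rw [← (wedgeForm_isAlt φ).neg, h0, neg_zero]
  refine exteriorPower.linearMap_ext (Basis.ext_alternating e fun v _ => ?_)
  simp only [LinearMap.compAlternatingMap_apply, LinearMap.comp_apply, hM, hψ]
  have hv : (fun i => e (v i)) = ![e (v 0), e (v 1)] := by ext i; fin_cases i <;> rfl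
  rw [hv, ← wedgeForm_apply]
  have hB := fun i j => (wedgeForm_isAlt φ).neg (e i) (e j)
  have hS := fun i => (wedgeForm_isAlt φ).self_eq_zero (e i)
  generalize v 0 = i
  generalize v 1 = j
  rw [Basis.det_apply, ← he, det_fin_four_of_col_zero _ (by simp [Basis.toMatrix_apply])
    (fun k => by simp [Basis.toMatrix_apply, Fin.succ_ne_zero])]
  fin_cases i <;> fin_cases j <;>
    simp [Basis.toMatrix_apply, w, h0, h1, hS, ← hB 1 2, ← hB 2 3, ← hB 3 1]

theorem card_isotropic_pairs {F : Type*} [Field F] [Fintype F] {V : Type*} [AddCommGroup V]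
    [Module F V] [FiniteDimensional F V] (B : V →ₗ[F] V →ₗ[F] F) (hB : B.IsAlt)
    (hnd : ∀ v, v ≠ 0 → B v ≠ 0) :
    Nat.card {ω : Fin 2 → V // LinearIndependent F ω ∧ B (ω 0) (ω 1) = 0} =
      (Fintype.card F ^ finrank F V - 1) *
        (Fintype.card F ^ (finrank F V - 1) - Fintype.card F) := by
  have : Finite V := Module.finite_of_finite F
  have : Fintype {v : V // v ≠ 0} := Fintype.ofFinite _
  have hv (v : {v : V // v ≠ 0}) :
      Nat.card ↥((LinearMap.ker (B v) : Set V) \ Submodule.span F {v.1}) =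
        Fintype.card F ^ (finrank F V - 1) - Fintype.card F := by
    have hle : (Submodule.span F {v.1} : Set V) ⊆ LinearMap.ker (B v) := by
      rw [SetLike.coe_subset_coe, Submodule.span_singleton_le_iff_mem]
      exact hB v
    have hk := Module.Dual.finrank_ker_add_one_of_ne_zero (hnd v v.2)
    rw [Nat.card_coe_set_eq, Set.ncard_sdiff hle, ← Nat.card_coe_set_eq, ← Nat.card_coe_set_eq,
      SetLike.coe_sort_coe, SetLike.coe_sort_coe, Module.natCard_eq_pow_finrank (K := F),
      Module.natCard_eq_pow_finrank (K := F) (V := Submodule.span F {v.1}),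
      finrank_span_singleton v.2, pow_one, Nat.card_eq_fintype_card, ← hk, Nat.add_sub_cancel]
  have hp (v w : V) (h : v ≠ 0) :
      LinearIndependent F ![v, w] ↔ w ∉ Submodule.span F {v} := by
    simp [LinearIndependent.pair_iff' h, Submodule.mem_span_singleton]
  have hω (ω : Fin 2 → V) : ω = ![ω 0, ω 1] := by
    ext i; fin_cases i <;> rfl
  let f : {ω : Fin 2 → V // LinearIndependent F ω ∧ B (ω 0) (ω 1) = 0} ≃
      Σ v : {v : V // v ≠ 0}, ↥((LinearMap.ker (B v) : Set V) \ Submodule.span F {v.1}) :=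
    { toFun := fun ω => ⟨⟨ω.1 0, ω.2.1.ne_zero 0⟩, ω.1 1, ω.2.2, by
        have := ω.2.1
        rwa [hω ω.1, hp _ _ (ω.2.1.ne_zero 0)] at this⟩
      invFun := fun p => ⟨![p.1, p.2], (hp _ _ p.1.2).2 p.2.2.2, p.2.2.1⟩
      left_inv := fun ω => Subtype.ext (hω ω.1).symm
      right_inv := fun p => rfl }
  rw [Nat.card_congr f, Nat.card_sigma]
  simp only [hv, Finset.sum_const, smul_eq_mul, Finset.card_univ, ← Nat.card_eq_fintype_card]
  congr 1
  have := Set.ncard_compl ({0} : Set V)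
  rw [Set.ncard_singleton, Module.natCard_eq_pow_finrank (K := F)] at this
  exact this

theorem card_isotropic_pairs_eq_mul {F : Type*} [Field F] [Fintype F] {V : Type*} [AddCommGroup V]
    [Module F V] [FiniteDimensional F V] (B : V →ₗ[F] V →ₗ[F] F) (hB : B.IsAlt) :
    Nat.card {ω : Fin 2 → V // LinearIndependent F ω ∧ B (ω 0) (ω 1) = 0} =
      Nat.card {L : Submodule F V // finrank F L = 2 ∧ ∀ x ∈ L, ∀ y ∈ L, B x y = 0} *
        ((Fintype.card F ^ 2 - 1) * (Fintype.card F ^ 2 - Fintype.card F)) := by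
  have : Finite V := Module.finite_of_finite F
  have : Fintype {L : Submodule F V // finrank F L = 2 ∧ ∀ x ∈ L, ∀ y ∈ L, B x y = 0} :=
    Fintype.ofFinite _
  have hspan (L : Submodule F V) (hL : finrank F L = 2) (ω : Fin 2 → L)
      (hω : LinearIndependent F ω) : Submodule.span F (Set.range fun i => (ω i : V)) = L := by
    have := congrArg (Submodule.map L.subtype) (hω.span_eq_top_of_card_eq_finrank (by simp [hL]))
    rwa [Submodule.map_span, ← Set.range_comp, Submodule.map_top, L.range_subtype] at this
  let f : {ω : Fin 2 → V // LinearIndependent F ω ∧ B (ω 0) (ω 1) = 0} ≃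
      Σ L : {L : Submodule F V // finrank F L = 2 ∧ ∀ x ∈ L, ∀ y ∈ L, B x y = 0},
        {ω : Fin 2 → L.1 // LinearIndependent F ω} :=
    (Equiv.ofBijective (fun p => ⟨fun i => p.2.1 i,
      p.2.2.map' p.1.1.subtype p.1.1.ker_subtype, p.1.2.2 _ (p.2.1 0).2 _ (p.2.1 1).2⟩) (by
        constructor
        · rintro ⟨⟨L, hL⟩, ω, hω⟩ ⟨⟨L', hL'⟩, ω', hω'⟩ h
          have h' := congrArg Subtype.val h
          have : L = L' := by
            rw [← hspan L hL.1 ω hω, ← hspan L' hL'.1 ω' hω']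
            exact congrArg (fun g => Submodule.span F (Set.range g)) h'
          subst this
          congr 2
          funext i
          exact Subtype.ext (congrFun h' i)
        · rintro ⟨ω, hω, h⟩
          refine ⟨⟨⟨Submodule.span F (Set.range ω), ?_, ?_⟩,
            fun i => ⟨ω i, Submodule.subset_span ⟨i, rfl⟩⟩, ?_⟩, rfl⟩
          · simpa using finrank_span_eq_card hω
          · exact hB.apply_eq_zero_of_mem_span_range h
          · exact linearIndependent_span hω)).symm
  have hc (L : {L : Submodule F V // finrank F L = 2 ∧ ∀ x ∈ L, ∀ y ∈ L, B x y = 0}) :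
      Nat.card {ω : Fin 2 → L.1 // LinearIndependent F ω} =
        (Fintype.card F ^ 2 - 1) * (Fintype.card F ^ 2 - Fintype.card F) := by
    rw [card_linearIndependent L.2.1.ge, L.2.1, Fin.prod_univ_two]
    simp
  rw [Nat.card_congr f, Nat.card_sigma]
  simp only [hc, Finset.sum_const, smul_eq_mul, Finset.card_univ, ← Nat.card_eq_fintype_card]

/-- Let `V` have dimension `4` and let `Π` be a nondecomposable hyperplane of `P(⋀^2 V)`.
Then `|Π ∩ G(2,V)| = q³ + q² + q + 1`. -/
theorem stmt17 (F : Type*) [Field F] [Fintype F] (V : Type*) [AddCommGroup V] [Module F V]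
    [FiniteDimensional F V] (q : ℕ) (hq : Fintype.card F = q)
    (hV : finrank F V = 4)
    (φ : ⋀[F]^2 V →ₗ[F] F) (hφ : φ ≠ 0)
    (hnd : ¬ IsDecomposable F V 4 2 (by omega) φ) :
    Nat.card {L : Submodule F V | finrank F L = 2 ∧ LiesOn F V 2 φ L} =
      q ^ 3 + q ^ 2 + q + 1 := by
  subst hq
  have hcount := (card_isotropic_pairs_eq_mul (wedgeForm φ) (wedgeForm_isAlt φ)).symm.trans
    (card_isotropic_pairs (wedgeForm φ) (wedgeForm_isAlt φ)
      fun u hu h => hnd (isDecomposable_of_wedgeForm_eq_zero hV φ hu h))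
  rw [hV] at hcount
  have hset : {L : Submodule F V | finrank F L = 2 ∧ LiesOn F V 2 φ L} =
      {L : Submodule F V | finrank F L = 2 ∧ ∀ x ∈ L, ∀ y ∈ L, wedgeForm φ x y = 0} :=
    Set.ext fun L => and_congr_right (liesOn_two_iff φ L)
  rw [hset, Set.coe_ofPred]
  have h1 : 1 < Fintype.card F := Fintype.one_lt_card
  generalize Fintype.card F = q at hcount h1
  have hq2 : q < q ^ 2 := lt_self_pow₀ h1 (by decide)
  refine Nat.eq_of_mul_eq_mul_right
    (Nat.mul_pos (Nat.sub_pos_of_lt (h1.trans hq2)) (Nat.sub_pos_of_lt hq2)) (hcount.trans ?_)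
  have hq3 : q ≤ q ^ 3 := Nat.le_self_pow (by decide) q
  have hq4 : 1 ≤ q ^ 4 := Nat.one_le_pow _ _ (by omega)
  zify [hq2.le, (h1.trans hq2).le, hq3, hq4]
  ring
end
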